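/- arXiv:2011.12602 — 3 statements merged into one kernel-verified Lean document; each statement's English description precedes it below -/
import Mathlib

section
/- Let $\omega \subseteq \mathbb{R}^2$ be a bounded measurable set, let $b > 0$, and set $\Omega_b = \omega \times (0, b) \subseteq \mathbb{R}^3$. Let $\eta : \mathbb{R}^3 \to \mathbb{R}^3$ be continuously differentiable and let $w : \mathbb{R}^2 \to \mathbb{R}$ satisfy the interface condition $\eta(x_1, x_2, 0) = (0, 0, w(x_1, x_2))$ for all $(x_1, x_2) \in \omega$. Then $\int_{\Omega_b} \|\eta(x)\|^2 \, dx \le 2b \int_\omega w(x_1,x_2)^2 \, d(x_1,x_2) + 2b^2 \int_{\Omega_b} \|\partial_{x_3}\eta(x)\|^2 \, dx$. -/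
open MeasureTheory

lemma aux_cs (b : ℝ) (hb : 0 < b) (f : ℝ → ℝ) (hf : Continuous f) :
    (∫ t in (0:ℝ)..b, f t) ^ 2 ≤ b * ∫ t in (0:ℝ)..b, f t ^ 2 := by
  set F := ∫ t in (0:ℝ)..b, f t with hF
  have h0 : 0 ≤ ∫ t in (0:ℝ)..b, (f t - F / b) ^ 2 :=
    intervalIntegral.integral_nonneg hb.le (fun t _ => sq_nonneg _)
  have h1 : ∫ t in (0:ℝ)..b, (f t - F / b) ^ 2
      = (∫ t in (0:ℝ)..b, f t ^ 2) - 2 * (F / b) * F + b * (F / b) ^ 2 := by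
    have : (fun t => (f t - F / b) ^ 2)
        = fun t => (f t ^ 2 - 2 * (F / b) * f t) + (F / b) ^ 2 := by
      ext t; ring
    rw [this, intervalIntegral.integral_add, intervalIntegral.integral_sub,
      intervalIntegral.integral_const_mul, intervalIntegral.integral_const]
    · simp [hF]
    all_goals exact Continuous.intervalIntegrable (by fun_prop) _ _
  rw [h1] at h0
  have h2 : b * ((∫ t in (0:ℝ)..b, f t ^ 2) - 2 * (F / b) * F + b * (F / b) ^ 2)
      = b * (∫ t in (0:ℝ)..b, f t ^ 2) - F ^ 2 := by
    field_simp; ring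
  have h3 := mul_nonneg hb.le h0
  rw [h2] at h3
  linarith

lemma aux_pt {E : Type*} [NormedAddCommGroup E] [NormedSpace ℝ E] [CompleteSpace E]
    (b : ℝ) (g g' : ℝ → E) (hg : ∀ t, HasDerivAt g (g' t) t)
    (hc : Continuous g') (s : ℝ) (hs : s ∈ Set.Ioo 0 b) :
    ‖g s‖ ^ 2 ≤ 2 * ‖g 0‖ ^ 2 + 2 * (b * ∫ t in Set.Ioo (0:ℝ) b, ‖g' t‖ ^ 2) := by
  have hb : 0 < b := hs.1.trans hs.2
  have h1 : ∫ t in (0:ℝ)..s, g' t = g s - g 0 :=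
    intervalIntegral.integral_eq_sub_of_hasDerivAt (fun t _ => hg t) (hc.intervalIntegrable _ _)
  have h2 : ‖g s - g 0‖ ≤ ∫ t in (0:ℝ)..b, ‖g' t‖ := by
    rw [← h1]
    refine (intervalIntegral.norm_integral_le_integral_norm hs.1.le).trans ?_
    exact intervalIntegral.integral_mono_interval le_rfl hs.1.le hs.2.le
      (Filter.Eventually.of_forall fun t => norm_nonneg _) (hc.norm.intervalIntegrable _ _)
  have h3 := aux_cs b hb (fun t => ‖g' t‖) hc.norm
  rw [← integral_Ioc_eq_integral_Ioo, ← intervalIntegral.integral_of_le hb.le]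
  have h4 : ‖g s‖ ≤ ‖g 0‖ + ‖g s - g 0‖ := by
    simpa using norm_add_le (g 0) (g s - g 0)
  have h5 : ‖g s - g 0‖ ^ 2 ≤ (∫ t in (0:ℝ)..b, ‖g' t‖) ^ 2 :=
    pow_le_pow_left₀ (norm_nonneg _) h2 2
  have h6 : ‖g s‖ ^ 2 ≤ (‖g 0‖ + ‖g s - g 0‖) ^ 2 := pow_le_pow_left₀ (norm_nonneg _) h4 2
  nlinarith [sq_nonneg (‖g 0‖ - ‖g s - g 0‖)]

lemma aux_int {X : Type*} [PseudoMetricSpace X] [ProperSpace X] [MeasurableSpace X]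
    [OpensMeasurableSpace X] (μ : Measure X)
    [IsFiniteMeasureOnCompacts μ] (S : Set X) (hS : Bornology.IsBounded S)
    (f : X → ℝ) (hf : Continuous f) : IntegrableOn f S μ :=
  (hf.continuousOn.integrableOn_compact' hS.isCompact_closure
    isClosed_closure.measurableSet).mono_set subset_closure



/-- Poincaré-type inequality for the Biot displacement `η` on the slab
`Ω_b = ω × (0,b)`, with `L²` control obtained from the interface condition
`η|_{x₃ = 0} = w e₃`.  Here `ℝ³` is modelled as `(ℝ × ℝ) × ℝ` and the values
of `η` live in Euclidean `ℝ³`, so `‖·‖` is the Euclidean norm; `∂_{x₃} η` is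
the derivative of `η` in the last coordinate. -/
theorem stmt2 (b : ℝ) (hb : 0 < b) (ω : Set (ℝ × ℝ))
    (hωb : Bornology.IsBounded ω) (hωm : MeasurableSet ω)
    (η : (ℝ × ℝ) × ℝ → EuclideanSpace ℝ (Fin 3)) (hη : ContDiff ℝ 1 η)
    (w : ℝ × ℝ → ℝ)
    (hint : ∀ p ∈ ω, η (p, 0) 0 = 0 ∧ η (p, 0) 1 = 0 ∧ η (p, 0) 2 = w p) :
    (∫ x in ω ×ˢ Set.Ioo (0 : ℝ) b, ‖η x‖ ^ 2)
      ≤ 2 * b * (∫ p in ω, (w p) ^ 2)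
        + 2 * b ^ 2 * ∫ x in ω ×ˢ Set.Ioo (0 : ℝ) b,
            ‖deriv (fun s : ℝ => η (x.1, s)) x.2‖ ^ 2 := by
  have hηc := hη.continuous
  have hder : ∀ x : (ℝ × ℝ) × ℝ,
      HasDerivAt (fun s : ℝ => η (x.1, s)) (fderiv ℝ η x (0, 1)) x.2 := by
    intro x
    have h1 : HasFDerivAt η (fderiv ℝ η x) (x.1, x.2) :=
      (hη.differentiable one_ne_zero x).hasFDerivAt
    have h2 : HasDerivAt (fun s : ℝ => (x.1, s)) ((0 : ℝ × ℝ), (1 : ℝ)) x.2 :=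
      (hasDerivAt_const _ _).prodMk (hasDerivAt_id _)
    exact h1.comp_hasDerivAt x.2 h2
  have hD : (fun x : (ℝ × ℝ) × ℝ => ‖deriv (fun s : ℝ => η (x.1, s)) x.2‖ ^ 2)
      = fun x => ‖fderiv ℝ η x (0, 1)‖ ^ 2 := by
    ext x; rw [(hder x).deriv]
  rw [hD]
  have hDc : Continuous (fun x => fderiv ℝ η x ((0 : ℝ × ℝ), (1 : ℝ))) :=
    (hη.continuous_fderiv one_ne_zero).clm_apply continuous_const
  set D := fun x => fderiv ℝ η x ((0 : ℝ × ℝ), (1 : ℝ)) with hDdef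
  have hS : Bornology.IsBounded (ω ×ˢ Set.Ioo (0 : ℝ) b) := hωb.prod (Metric.isBounded_Ioo 0 b)
  have hi1 : IntegrableOn (fun x => ‖η x‖ ^ 2) (ω ×ˢ Set.Ioo (0 : ℝ) b)
      ((volume : Measure (ℝ × ℝ)).prod (volume : Measure ℝ)) :=
    aux_int _ _ hS _ (by fun_prop)
  have hi2 : IntegrableOn (fun x => ‖D x‖ ^ 2) (ω ×ˢ Set.Ioo (0 : ℝ) b)
      ((volume : Measure (ℝ × ℝ)).prod (volume : Measure ℝ)) :=
    aux_int _ _ hS _ (by fun_prop)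
  have hw : ∀ p ∈ ω, w p ^ 2 = ‖η (p, 0)‖ ^ 2 := by
    intro p hp
    obtain ⟨h0, h1, h2⟩ := hint p hp
    rw [EuclideanSpace.norm_sq_eq, Fin.sum_univ_three, h0, h1, h2]
    simp
  have hi3 : IntegrableOn (fun p => ‖η (p, 0)‖ ^ 2) ω :=
    aux_int _ _ hωb _ (by fun_prop)
  rw [setIntegral_congr_fun hωm hw]
  have e1 := setIntegral_prod _ hi1
  have e2 := setIntegral_prod _ hi2
  rw [← Measure.volume_eq_prod] at e1 e2
  rw [e1]
  change _ ≤ _ + 2 * b ^ 2 * ∫ x in ω ×ˢ Set.Ioo (0 : ℝ) b, ‖D x‖ ^ 2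
  rw [e2, ← integral_const_mul, ← integral_const_mul]
  have hj1 : IntegrableOn (fun p => ∫ s in Set.Ioo (0 : ℝ) b, ‖η (p, s)‖ ^ 2) ω := by
    have := hi1
    rw [IntegrableOn, ← Measure.prod_restrict] at this
    exact this.integral_prod_left
  have hj2 : IntegrableOn (fun p => ∫ s in Set.Ioo (0 : ℝ) b, ‖D (p, s)‖ ^ 2) ω := by
    have := hi2
    rw [IntegrableOn, ← Measure.prod_restrict] at this
    exact this.integral_prod_left
  rw [← integral_add (hi3.const_mul _) (hj2.const_mul _)]
  refine setIntegral_mono_on hj1 ((hi3.const_mul _).add (hj2.const_mul _)) hωm ?_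
  intro p _
  have hpt : ∀ s ∈ Set.Ioo (0 : ℝ) b, ‖η (p, s)‖ ^ 2 ≤
      2 * ‖η (p, 0)‖ ^ 2 + 2 * (b * ∫ t in Set.Ioo (0:ℝ) b, ‖D (p, t)‖ ^ 2) :=
    fun s hs => aux_pt b (fun s => η (p, s)) (fun s => D (p, s)) (fun t => hder (p, t))
      (by fun_prop) s hs
  have hm := setIntegral_mono_on (μ := volume)
    (aux_int volume (Set.Ioo (0 : ℝ) b) (Metric.isBounded_Ioo 0 b)
      (fun s => ‖η (p, s)‖ ^ 2) (by fun_prop))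
    (aux_int volume (Set.Ioo (0 : ℝ) b) (Metric.isBounded_Ioo 0 b) _ continuous_const)
    measurableSet_Ioo hpt
  refine hm.trans (le_of_eq ?_)
  rw [setIntegral_const]
  simp only [Real.volume_real_Ioo_of_le hb.le, smul_eq_mul]
  ring
end

section
/- Let $h > 0$, let $\omega \subseteq \mathbb{R}^2$ be a bounded measurable set, and let $p : \mathbb{R}^3 \to \mathbb{R}$ be continuously differentiable. Then $\int_\omega p(x_1, x_2, h/2)^2 \, d(x_1,x_2) \le \frac{4}{h} \int_{\omega \times (0, h/2)} p(x)^2 \, dx + h \int_{\omega \times (0, h/2)} \big(\partial_{x_3} p(x)\big)^2 \, dx$. -/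
open MeasureTheory

theorem aux1 (h : ℝ) (hh : 0 < h) (f g : ℝ → ℝ) (hf : Continuous f) (hg : Continuous g)
    (hd : ∀ s, HasDerivAt f (g s) s) :
    f (h / 2) ^ 2 ≤ ∫ s in Set.Ioo (0 : ℝ) (h / 2), (4 / h * f s ^ 2 + h * g s ^ 2) := by
  rw [← integral_Ioc_eq_integral_Ioo, ← intervalIntegral.integral_of_le (by positivity)]
  have h1 : ∫ s in (0 : ℝ)..(h / 2), (2 / h) * (f s ^ 2 + s * (2 * f s * g s)) = f (h / 2) ^ 2 := by
    rw [intervalIntegral.integral_eq_sub_of_hasDerivAt (f := fun s => (2 / h) * (s * f s ^ 2))]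
    · field_simp
      ring
    · intro s _
      have := ((hasDerivAt_id s).mul ((hd s).pow 2)).const_mul (2 / h)
      exact this.congr_deriv (by simp)
    · apply Continuous.intervalIntegrable
      fun_prop
  rw [← h1]
  apply intervalIntegral.integral_mono_on (by positivity)
  · apply Continuous.intervalIntegrable
    fun_prop
  · apply Continuous.intervalIntegrable
    fun_prop
  · intro s hs
    have h2 : s * (2 * f s * g s) ≤ f s ^ 2 + (h / 2) ^ 2 * g s ^ 2 := by
      have : s ^ 2 * g s ^ 2 ≤ (h / 2) ^ 2 * g s ^ 2 := by
        have := hs.1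
        have := hs.2
        gcongr
      nlinarith [sq_nonneg (f s - s * g s)]
    calc (2 / h) * (f s ^ 2 + s * (2 * f s * g s))
        ≤ (2 / h) * (f s ^ 2 + (f s ^ 2 + (h / 2) ^ 2 * g s ^ 2)) := by gcongr
      _ = 4 / h * f s ^ 2 + h / 2 * g s ^ 2 := by field_simp; ring
      _ ≤ _ := by
        gcongr
        linarith

theorem aux2 {X : Type*} [PseudoMetricSpace X] [ProperSpace X] [MeasurableSpace X] [BorelSpace X]
    (μ : Measure X) [IsFiniteMeasureOnCompacts μ]
    (s : Set X) (hs : Bornology.IsBounded s) (f : X → ℝ) (hf : Continuous f) :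
    IntegrableOn f s μ :=
  (hf.continuousOn.integrableOn_compact' hs.isCompact_closure isClosed_closure.measurableSet).mono_set
    subset_closure

/-- Trace estimate on the surface `{x₃ = h/2}` of the slab `ω × (0, h/2)`.
Here `ℝ³` is modelled as `(ℝ × ℝ) × ℝ` and `∂_{x₃} p` is the derivative of `p`
in the last coordinate. -/
theorem stmt4 (h : ℝ) (hh : 0 < h) (ω : Set (ℝ × ℝ))
    (hωb : Bornology.IsBounded ω) (hωm : MeasurableSet ω)
    (p : (ℝ × ℝ) × ℝ → ℝ) (hp : ContDiff ℝ 1 p) :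
    (∫ q in ω, (p (q, h / 2)) ^ 2)
      ≤ 4 / h * (∫ x in ω ×ˢ Set.Ioo (0 : ℝ) (h / 2), (p x) ^ 2)
        + h * ∫ x in ω ×ˢ Set.Ioo (0 : ℝ) (h / 2),
            (deriv (fun s : ℝ => p (x.1, s)) x.2) ^ 2 := by
  have hd : ∀ (q : ℝ × ℝ) (s : ℝ),
      HasDerivAt (fun s : ℝ => p (q, s)) (fderiv ℝ p (q, s) (0, 1)) s := by
    intro q s
    have h1 : HasFDerivAt p (fderiv ℝ p (q, s)) (q, s) :=
      (hp.differentiable one_ne_zero _).hasFDerivAt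
    have h2 : HasDerivAt (fun s : ℝ => (q, s)) ((0 : ℝ × ℝ), (1 : ℝ)) s :=
      (hasDerivAt_const s q).prodMk (hasDerivAt_id s)
    exact h1.comp_hasDerivAt s h2
  have hg : Continuous fun x => fderiv ℝ p x (0, 1) :=
    (hp.continuous_fderiv one_ne_zero).clm_apply continuous_const
  have hpc : Continuous p := hp.continuous
  have e : ∀ x : (ℝ × ℝ) × ℝ, deriv (fun s : ℝ => p (x.1, s)) x.2 = fderiv ℝ p x (0, 1) :=
    fun x => (hd x.1 x.2).deriv
  simp only [e]
  have hb : Bornology.IsBounded (ω ×ˢ Set.Ioo (0 : ℝ) (h / 2)) :=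
    hωb.prod (Metric.isBounded_Ioo _ _)
  rw [← integral_const_mul, ← integral_const_mul,
    ← integral_add (aux2 _ _ hb _ (by fun_prop)) (aux2 _ _ hb _ (by fun_prop))]
  have hI : IntegrableOn (fun x => 4 / h * p x ^ 2 + h * (fderiv ℝ p x (0, 1)) ^ 2)
      (ω ×ˢ Set.Ioo (0 : ℝ) (h / 2)) (volume.prod volume) := aux2 _ _ hb _ (by fun_prop)
  rw [Measure.volume_eq_prod (ℝ × ℝ) ℝ, setIntegral_prod _ hI]
  rw [IntegrableOn, ← Measure.prod_restrict] at hI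
  refine setIntegral_mono (aux2 _ _ hωb _ (by fun_prop)) hI.integral_prod_left ?_
  intro q
  exact aux1 h hh (fun s => p (q, s)) (fun s => fderiv ℝ p (q, s) (0, 1)) (by fun_prop)
    (hg.comp (by fun_prop)) (hd q)
end

section
/- Let $h > 0$, $b > 0$, and let $\omega \subseteq \mathbb{R}^2$ be a bounded measurable set. There exists a constant $C > 0$, depending only on $h$ and $b$ (and not on $\omega$ or the functions below), such that for all continuously differentiable functions $p_p : \mathbb{R}^3 \to \mathbb{R}$ and $p_b : \mathbb{R}^3 \to \mathbb{R}$ satisfying the interface condition $p_b(x_1, x_2, 0) = p_p(x_1, x_2, h/2)$ for all $(x_1, x_2) \in \omega$, one has $\int_{\omega \times (0, b)} p_b^2 \, dx \le C \Big( \int_{\omega \times (0, h/2)} \big( p_p^2 + (\partial_{x_3} p_p)^2 \big) \, dx + \int_{\omega \times (0, b)} \|\nabla p_b\|^2 \, dx \Big)$. -/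
open MeasureTheory

lemma cs_aux (g : ℝ → ℝ) (hg : Continuous g) (x y : ℝ) (hxy : x ≤ y) :
    (∫ t in x..y, g t) ^ 2 ≤ (y - x) * ∫ t in x..y, (g t) ^ 2 := by
  rcases hxy.eq_or_lt with rfl | hlt
  · simp
  have h1 : ∀ c : ℝ, 0 ≤ (∫ t in x..y, (g t) ^ 2) - 2 * c * (∫ t in x..y, g t) + c ^ 2 * (y - x) := by
    intro c
    have h0 : 0 ≤ ∫ t in x..y, (g t - c) ^ 2 :=
      intervalIntegral.integral_nonneg hxy (fun _ _ => sq_nonneg _)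
    have e : ∫ t in x..y, (g t - c) ^ 2
        = (∫ t in x..y, (g t) ^ 2) - 2 * c * (∫ t in x..y, g t) + c ^ 2 * (y - x) := by
      have : ∀ t, (g t - c) ^ 2 = ((g t) ^ 2 - 2 * c * g t) + c ^ 2 := fun t => by ring
      simp_rw [this]
      rw [intervalIntegral.integral_add, intervalIntegral.integral_sub,
        intervalIntegral.integral_const_mul, intervalIntegral.integral_const]
      · simp only [smul_eq_mul]; ring
      all_goals exact Continuous.intervalIntegrable (by fun_prop) _ _
    linarith
  have hd : 0 < y - x := sub_pos.2 hlt
  have h2 := h1 ((∫ t in x..y, g t) / (y - x))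
  have h3 := mul_nonneg hd.le h2
  have h4 : (y - x) * ((∫ t in x..y, (g t) ^ 2)
      - 2 * ((∫ t in x..y, g t) / (y - x)) * (∫ t in x..y, g t)
      + ((∫ t in x..y, g t) / (y - x)) ^ 2 * (y - x))
      = (y - x) * (∫ t in x..y, (g t) ^ 2) - (∫ t in x..y, g t) ^ 2 := by
    field_simp
    ring
  linarith

lemma diff_aux (f g : ℝ → ℝ) (hf : ∀ t, HasDerivAt f (g t) t) (hg : Continuous g)
    (L x y : ℝ) (hx : 0 ≤ x) (hxy : x ≤ y) (hy : y ≤ L) :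
    (f y - f x) ^ 2 ≤ L * ∫ t in (0:ℝ)..L, (g t) ^ 2 := by
  have e : ∫ t in x..y, g t = f y - f x :=
    intervalIntegral.integral_eq_sub_of_hasDerivAt (fun t _ => hf t) (hg.intervalIntegrable _ _)
  rw [← e]
  have hm : ∫ t in x..y, (g t) ^ 2 ≤ ∫ t in (0:ℝ)..L, (g t) ^ 2 :=
    intervalIntegral.integral_mono_interval hx hxy hy
      (Filter.Eventually.of_forall fun t => sq_nonneg _)
      (Continuous.intervalIntegrable (by fun_prop) _ _)
  have h0 : 0 ≤ ∫ t in x..y, (g t) ^ 2 :=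
    intervalIntegral.integral_nonneg hxy (fun _ _ => sq_nonneg _)
  exact (cs_aux g hg x y hxy).trans (mul_le_mul (by linarith) hm h0 (by linarith))

lemma pt_aux (f g : ℝ → ℝ) (hf : ∀ t, HasDerivAt f (g t) t) (hg : Continuous g)
    (L x y : ℝ) (hx : x ∈ Set.Icc 0 L) (hy : y ∈ Set.Icc 0 L) :
    (f y) ^ 2 ≤ 2 * (f x) ^ 2 + 2 * (L * ∫ t in (0:ℝ)..L, (g t) ^ 2) := by
  have : (f y - f x) ^ 2 ≤ L * ∫ t in (0:ℝ)..L, (g t) ^ 2 := by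
    rcases le_total x y with hh | hh
    · exact diff_aux f g hf hg L x y hx.1 hh hy.2
    · have := diff_aux f g hf hg L y x hy.1 hh hx.2
      nlinarith
  nlinarith [sq_nonneg (f y - 2 * f x)]

lemma one_dim (f g : ℝ → ℝ) (hf : ∀ t, HasDerivAt f (g t) t) (hg : Continuous g)
    (u v : ℝ → ℝ) (hu : ∀ t, HasDerivAt u (v t) t) (hv : Continuous v)
    (L b : ℝ) (hL : 0 < L) (hb : 0 < b) (hi : u 0 = f L) :
    ∫ t in (0:ℝ)..b, (u t) ^ 2 ≤ (4 * b / L + 4 * b * L + 2 * b ^ 2) *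
      ((∫ t in (0:ℝ)..L, ((f t) ^ 2 + (g t) ^ 2)) + ∫ t in (0:ℝ)..b, (v t) ^ 2) := by
  have cf : Continuous f := continuous_iff_continuousAt.2 fun t => (hf t).continuousAt
  have cu : Continuous u := continuous_iff_continuousAt.2 fun t => (hu t).continuousAt
  set G := ∫ t in (0:ℝ)..L, (g t) ^ 2 with hG
  set V := ∫ t in (0:ℝ)..b, (v t) ^ 2 with hV
  have eF : ∫ t in (0:ℝ)..L, ((f t) ^ 2 + (g t) ^ 2) = (∫ t in (0:ℝ)..L, (f t) ^ 2) + G :=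
    intervalIntegral.integral_add (Continuous.intervalIntegrable (by fun_prop) _ _)
      (Continuous.intervalIntegrable (by fun_prop) _ _)
  rw [eF]
  have F0 : 0 ≤ ∫ t in (0:ℝ)..L, (f t) ^ 2 :=
    intervalIntegral.integral_nonneg hL.le (fun _ _ => sq_nonneg _)
  have G0 : 0 ≤ G := intervalIntegral.integral_nonneg hL.le (fun _ _ => sq_nonneg _)
  have V0 : 0 ≤ V := intervalIntegral.integral_nonneg hb.le (fun _ _ => sq_nonneg _)
  have A : ∫ t in (0:ℝ)..L, (f L) ^ 2 ≤ ∫ t in (0:ℝ)..L, (2 * (f t) ^ 2 + 2 * (L * G)) :=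
    intervalIntegral.integral_mono_on hL.le (Continuous.intervalIntegrable (by fun_prop) _ _)
      (Continuous.intervalIntegrable (by fun_prop) _ _)
      (fun t ht => pt_aux f g hf hg L t L ht ⟨hL.le, le_rfl⟩)
  have B : ∫ t in (0:ℝ)..b, (u t) ^ 2 ≤ ∫ t in (0:ℝ)..b, (2 * (u 0) ^ 2 + 2 * (b * V)) :=
    intervalIntegral.integral_mono_on hb.le (Continuous.intervalIntegrable (by fun_prop) _ _)
      (Continuous.intervalIntegrable (by fun_prop) _ _)
      (fun t ht => pt_aux u v hu hv b 0 t ⟨le_rfl, hb.le⟩ ht)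
  rw [intervalIntegral.integral_add (Continuous.intervalIntegrable (by fun_prop) _ _)
      (Continuous.intervalIntegrable (by fun_prop) _ _),
    intervalIntegral.integral_const_mul, intervalIntegral.integral_const,
    intervalIntegral.integral_const] at A
  rw [intervalIntegral.integral_const] at B
  simp only [smul_eq_mul, sub_zero] at A B
  set F := ∫ t in (0:ℝ)..L, (f t) ^ 2 with hF
  rw [hi] at B
  have A' : (f L) ^ 2 ≤ 2 * F / L + 2 * L * G := by
    have : 2 * F / L + 2 * L * G = (2 * F + L * (2 * (L * G))) / L := by field_simp
    rw [this, le_div_iff₀ hL]; linarith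
  have A2 := mul_le_mul_of_nonneg_left A' (show 0 ≤ 2 * b by positivity)
  have e1 : 2 * b * (2 * F / L + 2 * L * G) = 4 * b / L * F + 4 * b * L * G := by ring
  have p1 : 0 ≤ 4 * b / L * (G + V) := by positivity
  have p2 : 0 ≤ 4 * b * L * (F + V) := by positivity
  have p3 : 0 ≤ 2 * b ^ 2 * (F + G) := by positivity
  nlinarith

lemma slice_deriv (p : (ℝ × ℝ) × ℝ → ℝ) (hp : ContDiff ℝ 1 p) (q : ℝ × ℝ) (t : ℝ) :
    HasDerivAt (fun s : ℝ => p (q, s)) (fderiv ℝ p (q, t) ((0, 0), 1)) t := by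
  have h1 : HasFDerivAt p (fderiv ℝ p (q, t)) (q, t) :=
    (hp.differentiable (by norm_num) _).hasFDerivAt
  have h2 : HasDerivAt (fun s : ℝ => (q, s)) ((0 : ℝ × ℝ), (1 : ℝ)) t :=
    (hasDerivAt_const t q).prodMk (hasDerivAt_id t)
  exact h1.comp_hasDerivAt t h2

lemma int_aux (ω : Set (ℝ × ℝ)) (hω : Bornology.IsBounded ω) (a : ℝ)
    (F : (ℝ × ℝ) × ℝ → ℝ) (hF : Continuous F) :
    IntegrableOn F (ω ×ˢ Set.Ioo (0 : ℝ) a) := by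
  have hc : IsCompact (closure ω ×ˢ Set.Icc (0 : ℝ) a) := hω.isCompact_closure.prod isCompact_Icc
  exact (hF.continuousOn.integrableOn_compact hc).mono_set
    (Set.prod_mono subset_closure Set.Ioo_subset_Icc_self)

lemma fub_aux (ω : Set (ℝ × ℝ)) (hω : Bornology.IsBounded ω) (a : ℝ) (ha : 0 < a)
    (F : (ℝ × ℝ) × ℝ → ℝ) (hF : Continuous F) :
    IntegrableOn (fun q => ∫ t in (0:ℝ)..a, F (q, t)) ω ∧
    ∫ x in ω ×ˢ Set.Ioo (0 : ℝ) a, F x = ∫ q in ω, ∫ t in (0:ℝ)..a, F (q, t) := by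
  have hi := int_aux ω hω a F hF
  have e : ∀ q, ∫ t in (0:ℝ)..a, F (q, t) = ∫ t in Set.Ioo 0 a, F (q, t) := fun q => by
    rw [intervalIntegral.integral_of_le ha.le, integral_Ioc_eq_integral_Ioo]
  simp_rw [e]
  constructor
  · rw [IntegrableOn, Measure.volume_eq_prod, ← Measure.prod_restrict] at hi
    exact hi.integral_prod_left
  · rw [Measure.volume_eq_prod] at hi ⊢
    exact setIntegral_prod F hi

theorem stmt5 (h b : ℝ) (hh : 0 < h) (hb : 0 < b) :
    ∃ C : ℝ, 0 < C ∧
      ∀ (ω : Set (ℝ × ℝ)), Bornology.IsBounded ω → MeasurableSet ω →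
      ∀ (pp pb : (ℝ × ℝ) × ℝ → ℝ), ContDiff ℝ 1 pp → ContDiff ℝ 1 pb →
      (∀ q ∈ ω, pb (q, 0) = pp (q, h / 2)) →
      (∫ x in ω ×ˢ Set.Ioo (0 : ℝ) b, (pb x) ^ 2)
        ≤ C * ((∫ x in ω ×ˢ Set.Ioo (0 : ℝ) (h / 2),
                  ((pp x) ^ 2 + (deriv (fun s : ℝ => pp (x.1, s)) x.2) ^ 2))
              + ∫ x in ω ×ˢ Set.Ioo (0 : ℝ) b,
                  ((fderiv ℝ pb x ((1, 0), 0)) ^ 2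
                    + (fderiv ℝ pb x ((0, 1), 0)) ^ 2
                    + (fderiv ℝ pb x ((0, 0), 1)) ^ 2)) := by
  have hL : 0 < h / 2 := by positivity
  refine ⟨4 * b / (h / 2) + 4 * b * (h / 2) + 2 * b ^ 2, by positivity, ?_⟩
  intro ω hω hm pp pb hpp hpb hi
  set C := 4 * b / (h / 2) + 4 * b * (h / 2) + 2 * b ^ 2 with hC
  have hC0 : 0 < C := by positivity
  have cpp := hpp.continuous
  have cpb := hpb.continuous
  have dpp : Continuous (fderiv ℝ pp) := hpp.continuous_fderiv (by norm_num)
  have dpb : Continuous (fderiv ℝ pb) := hpb.continuous_fderiv (by norm_num)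
  have e : ∀ x : (ℝ × ℝ) × ℝ, deriv (fun s : ℝ => pp (x.1, s)) x.2 = fderiv ℝ pp x ((0, 0), 1) :=
    fun x => (slice_deriv pp hpp x.1 x.2).deriv
  simp_rw [e]
  have c3 : Continuous fun x => (fderiv ℝ pb x ((0, 0), 1)) ^ 2 := by fun_prop
  have c4 : Continuous fun x => (fderiv ℝ pb x ((1, 0), 0)) ^ 2
      + (fderiv ℝ pb x ((0, 1), 0)) ^ 2 + (fderiv ℝ pb x ((0, 0), 1)) ^ 2 := by fun_prop
  have hmono : ∫ x in ω ×ˢ Set.Ioo (0 : ℝ) b, (fderiv ℝ pb x ((0, 0), 1)) ^ 2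
      ≤ ∫ x in ω ×ˢ Set.Ioo (0 : ℝ) b, ((fderiv ℝ pb x ((1, 0), 0)) ^ 2
      + (fderiv ℝ pb x ((0, 1), 0)) ^ 2 + (fderiv ℝ pb x ((0, 0), 1)) ^ 2) :=
    integral_mono (int_aux ω hω b _ c3) (int_aux ω hω b _ c4) (fun x => by
      have h1 := sq_nonneg (fderiv ℝ pb x ((1, 0), 0))
      have h2 := sq_nonneg (fderiv ℝ pb x ((0, 1), 0))
      dsimp only
      linarith)
  refine le_trans ?_ (mul_le_mul_of_nonneg_left (add_le_add_right hmono _) hC0.le)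
  obtain ⟨i1, e1⟩ := fub_aux ω hω b hb (fun x => (pb x) ^ 2) (by fun_prop)
  obtain ⟨i2, e2⟩ := fub_aux ω hω (h / 2) hL
    (fun x => (pp x) ^ 2 + (fderiv ℝ pp x ((0, 0), 1)) ^ 2) (by fun_prop)
  obtain ⟨i3, e3⟩ := fub_aux ω hω b hb _ c3
  rw [e1, e2, e3, ← integral_add i2 i3, ← integral_const_mul]
  refine setIntegral_mono_on i1 ((i2.add i3).const_mul C) hm fun q hq => ?_
  exact one_dim (fun s => pp (q, s)) (fun s => fderiv ℝ pp (q, s) ((0, 0), 1))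
    (slice_deriv pp hpp q) (by fun_prop) (fun s => pb (q, s))
    (fun s => fderiv ℝ pb (q, s) ((0, 0), 1)) (slice_deriv pb hpb q) (by fun_prop)
    (h / 2) b hL hb (hi q hq)
end
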